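/- arXiv:2502.16151 — 3 statements merged into one kernel-verified Lean document; each statement's English description precedes it below -/
import Mathlib

section
/- Let ε > 0, C ≥ 0, r ≥ 1, and let ξ : ℝ³ → ℝ be differentiable with ‖∇ξ(z)‖ ≤ C·r^(−3/2−ε) for every z ∈ ℝ³ with ‖z‖ = r (Euclidean norm and gradient). Then for any x, y ∈ ℝ³ with ‖x‖ = ‖y‖ = r one has |ξ(x) − ξ(y)| ≤ π·C·r^(−1/2−ε). -/
open Real

/-- In a real inner product space of dimension at least two, every vector admits an orthogonal
vector of the same norm. -/
theorem exists_orthogonal_norm_eq {E : Type*} [NormedAddCommGroup E] [InnerProductSpace ℝ E]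
    [FiniteDimensional ℝ E] (hE : 1 < Module.finrank ℝ E) (x : E) :
    ∃ w : E, ‖w‖ = ‖x‖ ∧ inner ℝ x w = 0 := by
  have hpos : 0 < Module.finrank ℝ (ℝ ∙ x)ᗮ := by
    have h₁ := (ℝ ∙ x).finrank_add_finrank_orthogonal
    have h₂ : Module.finrank ℝ (ℝ ∙ x) ≤ 1 := by
      simpa using finrank_span_le_card (R := ℝ) ({x} : Set E)
    omega
  have : Nontrivial (ℝ ∙ x)ᗮ := Module.finrank_pos_iff.mp hpos
  obtain ⟨w, hw⟩ := exists_norm_eq (ℝ ∙ x)ᗮ (norm_nonneg x)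
  exact ⟨w, hw, Submodule.mem_orthogonal_singleton_iff_inner_right.mp w.2⟩

/-- Two vectors of equal norm are joined by a great-circle arc based at the first one. -/
theorem exists_eq_cos_angle_smul_add_sin_angle_smul {E : Type*} [NormedAddCommGroup E]
    [InnerProductSpace ℝ E] [FiniteDimensional ℝ E] (hE : 1 < Module.finrank ℝ E) {x y : E}
    (hxy : ‖x‖ = ‖y‖) :
    ∃ w : E, ‖w‖ = ‖x‖ ∧ inner ℝ x w = 0 ∧
      y = cos (InnerProductGeometry.angle x y) • x +
        sin (InnerProductGeometry.angle x y) • w := by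
  set t := InnerProductGeometry.angle x y with ht
  have hin : inner ℝ x y = cos t * ‖x‖ ^ 2 := by
    rw [← InnerProductGeometry.cos_angle_mul_norm_mul_norm x y, ← hxy]
    ring
  set v := y - cos t • x with hv
  have hxv : inner ℝ x v = 0 := by
    rw [hv, inner_sub_right, inner_smul_right, real_inner_self_eq_norm_sq, hin, sub_self]
  have hvn : ‖v‖ = sin t * ‖x‖ := by
    have hsq : ‖v‖ ^ 2 = (sin t * ‖x‖) ^ 2 := by
      rw [hv, norm_sub_sq_real, inner_smul_right, real_inner_comm, hin, norm_smul, ← hxy,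
        mul_pow, mul_pow, sin_sq, norm_eq_abs, sq_abs]
      ring
    exact (sq_eq_sq₀ (norm_nonneg v)
      (mul_nonneg (InnerProductGeometry.sin_angle_nonneg x y) (norm_nonneg x))).mp hsq
  by_cases hs : sin t = 0
  · obtain ⟨w, hw, hxw⟩ := exists_orthogonal_norm_eq hE x
    refine ⟨w, hw, hxw, ?_⟩
    have : v = 0 := by rw [← norm_eq_zero, hvn, hs, zero_mul]
    rw [hs, zero_smul, add_zero]
    exact sub_eq_zero.mp this
  · refine ⟨(sin t)⁻¹ • v, ?_, ?_, ?_⟩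
    · rw [norm_smul, hvn, norm_inv, norm_of_nonneg (InnerProductGeometry.sin_angle_nonneg x y),
        inv_mul_cancel_left₀ hs]
    · rw [inner_smul_right, hxv, mul_zero]
    · rw [smul_inv_smul₀ hs, hv, add_sub_cancel]

/-- Linear combinations of orthogonal vectors of equal norm with coefficients on the unit circle
keep that norm. -/
theorem norm_smul_add_smul_of_inner_eq_zero {E : Type*} [NormedAddCommGroup E]
    [InnerProductSpace ℝ E] {x w : E} (hw : ‖w‖ = ‖x‖) (hxw : inner ℝ x w = 0) {a b : ℝ}
    (hab : a ^ 2 + b ^ 2 = 1) : ‖a • x + b • w‖ = ‖x‖ := by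
  refine (sq_eq_sq₀ (norm_nonneg _) (norm_nonneg _)).mp ?_
  rw [norm_add_sq_real, inner_smul_left, inner_smul_right, hxw, norm_smul, norm_smul, hw,
    mul_pow, mul_pow, norm_eq_abs, norm_eq_abs, sq_abs, sq_abs]
  linear_combination ‖x‖ ^ 2 * hab

/-- A differentiable function whose derivative is bounded by `K` on a sphere varies by at most
`K` times the great-circle distance between two points of that sphere. -/
theorem abs_sub_le_mul_angle_of_norm_fderiv_le {E : Type*} [NormedAddCommGroup E]
    [InnerProductSpace ℝ E] [FiniteDimensional ℝ E] (hE : 1 < Module.finrank ℝ E) {f : E → ℝ}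
    (hf : Differentiable ℝ f) {K : ℝ} {x y : E} (hxy : ‖x‖ = ‖y‖)
    (hK : ∀ z, ‖z‖ = ‖x‖ → ‖fderiv ℝ f z‖ ≤ K) :
    |f y - f x| ≤ K * (‖x‖ * InnerProductGeometry.angle x y) := by
  obtain ⟨w, hw, hxw, hy⟩ := exists_eq_cos_angle_smul_add_sin_angle_smul hE hxy
  have hγ (s : ℝ) : HasDerivAt (fun s : ℝ => cos s • x + sin s • w)
      (-sin s • x + cos s • w) s :=
    ((hasDerivAt_cos s).smul_const x).add ((hasDerivAt_sin s).smul_const w)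
  have hfγ (s : ℝ) : HasDerivAt (fun s : ℝ => f (cos s • x + sin s • w))
      (fderiv ℝ f (cos s • x + sin s • w) (-sin s • x + cos s • w)) s :=
    (hf _).hasFDerivAt.comp_hasDerivAt s (hγ s)
  have hbound (s : ℝ) :
      ‖fderiv ℝ f (cos s • x + sin s • w) (-sin s • x + cos s • w)‖ ≤ K * ‖x‖ := by
    have hspeed : ‖-sin s • x + cos s • w‖ = ‖x‖ :=
      norm_smul_add_smul_of_inner_eq_zero hw hxw (by rw [neg_sq, sin_sq_add_cos_sq])
    have hpos : ‖cos s • x + sin s • w‖ = ‖x‖ :=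
      norm_smul_add_smul_of_inner_eq_zero hw hxw (cos_sq_add_sin_sq s)
    rw [← hspeed]
    exact ContinuousLinearMap.le_of_opNorm_le _ (hK _ hpos) _
  have h := norm_image_sub_le_of_norm_deriv_le_segment'
    (fun s _ => (hfγ s).hasDerivWithinAt) (fun s _ => hbound s)
    (InnerProductGeometry.angle x y)
    (Set.right_mem_Icc.mpr (InnerProductGeometry.angle_nonneg x y))
  rw [← hy] at h
  simpa [mul_assoc] using h

/-- If `ξ : ℝ³ → ℝ` is differentiable and its gradient is bounded by `C·r^(-3/2-ε)` on the
sphere of radius `r ≥ 1`, then the values of `ξ` at any two points of that sphere differ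
by at most `π·C·r^(-1/2-ε)`. -/
theorem angular_variation_bound
    (ε C r : ℝ) (hε : 0 < ε) (hC : 0 ≤ C) (hr : 1 ≤ r)
    (ξ : EuclideanSpace ℝ (Fin 3) → ℝ)
    (hdiff : Differentiable ℝ ξ)
    (hgrad : ∀ z : EuclideanSpace ℝ (Fin 3), ‖z‖ = r →
      ‖gradient ξ z‖ ≤ C * r ^ (-(3/2 : ℝ) - ε)) :
    ∀ x y : EuclideanSpace ℝ (Fin 3), ‖x‖ = r → ‖y‖ = r →
      |ξ x - ξ y| ≤ π * C * r ^ (-(1/2 : ℝ) - ε) := by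
  intro x y hx hy
  have hr₀ : 0 < r := zero_lt_one.trans_le hr
  have hvar := abs_sub_le_mul_angle_of_norm_fderiv_le (by simp) hdiff (hy.trans hx.symm)
    (K := C * r ^ (-(3/2 : ℝ) - ε)) fun z hz => by
      simpa [gradient] using hgrad z (hz.trans hy)
  have hpow : r ^ (-(1/2 : ℝ) - ε) = r ^ (-(3/2 : ℝ) - ε) * r := by
    rw [← rpow_add_one hr₀.ne']
    ring_nf
  calc |ξ x - ξ y|
      ≤ C * r ^ (-(3/2 : ℝ) - ε) * (‖y‖ * InnerProductGeometry.angle y x) := hvar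
    _ ≤ C * r ^ (-(3/2 : ℝ) - ε) * (r * π) := by
        rw [hy]
        gcongr
        exact InnerProductGeometry.angle_le_pi y x
    _ = π * C * r ^ (-(1/2 : ℝ) - ε) := by
        rw [hpow]
        ring
end

section
/- Let ε > 0, C ≥ 0, and let ξ : ℝ³ → ℝ be differentiable with ‖∇ξ(x)‖ ≤ C·‖x‖^(−3/2−ε) for all x ∈ ℝ³ with ‖x‖ ≥ 1 (Euclidean norm and gradient). Then there exists a constant c ∈ ℝ such that |ξ(x) − c| ≤ (π + 2)·C·‖x‖^(−1/2−ε) for all x with ‖x‖ ≥ 1; in particular ξ(x) → c as ‖x‖ → ∞. -/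
open Real Filter

section RadialDecay

variable {E : Type*} [NormedAddCommGroup E] [NormedSpace ℝ E] {ξ : E → ℝ} {C α : ℝ}

/-- Bound on the radial variation of a function whose derivative is `O(‖x‖ ^ (-1 - α))`. -/
theorem abs_sub_smul_le_of_fderiv_decay (hα : 0 < α) (hC : 0 ≤ C) (hdiff : Differentiable ℝ ξ)
    (hξ : ∀ x : E, 1 ≤ ‖x‖ → ‖fderiv ℝ ξ x‖ ≤ C * ‖x‖ ^ (-1 - α))
    {u : E} (hu : ‖u‖ = 1) {a b : ℝ} (ha : 1 ≤ a) (hab : a ≤ b) :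
    |ξ (b • u) - ξ (a • u)| ≤ C / α * a ^ (-α) := by
  have hf (r : ℝ) : HasDerivAt (fun r : ℝ ↦ ξ (r • u) - ξ (a • u)) (fderiv ℝ ξ (r • u) u) r := by
    have h : HasDerivAt (fun r : ℝ ↦ r • u) u r := by
      simpa using (hasDerivAt_id r).smul_const u
    exact ((hdiff (r • u)).hasFDerivAt.comp_hasDerivAt r h).sub_const _
  have hB (r : ℝ) (hr : r ∈ Set.Icc a b) :
      HasDerivAt (fun r : ℝ ↦ C / α * (a ^ (-α) - r ^ (-α))) (C * r ^ (-1 - α)) r := by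
    have hr0 : r ≠ 0 := by linarith [hr.1]
    have h := ((hasDerivAt_rpow_const (p := -α) (Or.inl hr0)).const_sub (a ^ (-α))).const_mul (C / α)
    refine h.congr_deriv ?_
    rw [show -α - 1 = -1 - α by ring]
    field_simp
  have key := image_norm_le_of_norm_deriv_right_le_deriv_boundary'
    (f := fun r : ℝ ↦ ξ (r • u) - ξ (a • u)) (f' := fun r ↦ fderiv ℝ ξ (r • u) u)
    (a := a) (b := b) (fun r _ ↦ (hf r).continuousAt.continuousWithinAt)
    (fun r _ ↦ (hf r).hasDerivWithinAt)
    (B := fun r : ℝ ↦ C / α * (a ^ (-α) - r ^ (-α))) (B' := fun r ↦ C * r ^ (-1 - α))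
    (by simp) (fun r hr ↦ (hB r hr).continuousAt.continuousWithinAt)
    (fun r hr ↦ (hB r (Set.Ico_subset_Icc_self hr)).hasDerivWithinAt)
    (by
      intro r hr
      have hr1 : 1 ≤ r := ha.trans hr.1
      have hn : ‖r • u‖ = r := by
        rw [norm_smul, hu, mul_one, Real.norm_of_nonneg (by linarith)]
      have h := hξ (r • u) (by rwa [hn])
      rw [hn] at h
      simpa [hu] using (ContinuousLinearMap.le_opNorm _ u).trans
        (mul_le_mul_of_nonneg_right h (norm_nonneg u)))
    (Set.right_mem_Icc.2 hab)
  refine key.trans (mul_le_mul_of_nonneg_left ?_ (by positivity))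
  have : 0 ≤ b ^ (-α) := rpow_nonneg (by linarith) _
  linarith

/-- Along two nearby directions, a function with derivative `O(‖x‖ ^ (-1 - α))` has the same
asymptotic behaviour. -/
theorem tendsto_sub_smul_of_fderiv_decay (hα : 0 < α) (hC : 0 ≤ C) (hdiff : Differentiable ℝ ξ)
    (hξ : ∀ x : E, 1 ≤ ‖x‖ → ‖fderiv ℝ ξ x‖ ≤ C * ‖x‖ ^ (-1 - α))
    {u v : E} (hu : ‖u‖ = 1) (huv : ‖v - u‖ < 1 / 2) :
    Tendsto (fun r : ℝ ↦ ξ (r • v) - ξ (r • u)) atTop (nhds 0) := by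
  have hlim : Tendsto (fun r : ℝ ↦ C * (r / 2) ^ (-α)) atTop (nhds 0) := by
    simpa using ((tendsto_rpow_neg_atTop hα).comp
      (tendsto_id.atTop_div_const (by norm_num : (0 : ℝ) < 2))).const_mul C
  refine squeeze_zero_norm' ?_ hlim
  filter_upwards [eventually_ge_atTop 2] with r hr
  have hn : ‖r • u‖ = r := by
    rw [norm_smul, hu, mul_one, Real.norm_of_nonneg (by linarith)]
  have hd : ‖r • v - r • u‖ ≤ r / 2 := by
    rw [← smul_sub, norm_smul, Real.norm_of_nonneg (by linarith)]
    nlinarith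
  have hbound : ∀ x ∈ Metric.closedBall (r • u) (r / 2),
      ‖fderiv ℝ ξ x‖ ≤ C * (r / 2) ^ (-1 - α) := by
    intro x hx
    have hx' : r / 2 ≤ ‖x‖ := by
      rw [mem_closedBall_iff_norm'] at hx
      have := norm_sub_norm_le (r • u) x
      linarith
    refine (hξ x (by linarith)).trans (mul_le_mul_of_nonneg_left ?_ hC)
    exact rpow_le_rpow_of_nonpos (by linarith) hx' (by linarith)
  have key := (convex_closedBall (r • u) (r / 2)).norm_image_sub_le_of_norm_fderiv_le
    (fun x _ ↦ hdiff x) hbound (Metric.mem_closedBall_self (by linarith))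
    (mem_closedBall_iff_norm.2 hd)
  have h0 : 0 < r / 2 := by linarith
  calc ‖ξ (r • v) - ξ (r • u)‖ ≤ C * (r / 2) ^ (-1 - α) * (r / 2) :=
        key.trans (mul_le_mul_of_nonneg_left hd (by positivity))
    _ = C * (r / 2) ^ (-α) := by
        rw [mul_assoc, ← rpow_add_one h0.ne']
        ring_nf

/-- In dimension at least two, a function with derivative `O(‖x‖ ^ (-1 - α))`, `α > 0`, is
asymptotic to a constant up to an error `O(‖x‖ ^ (-α))`. -/
theorem exists_abs_sub_le_of_fderiv_decay (hE : 1 < Module.rank ℝ E) (hα : 0 < α) (hC : 0 ≤ C)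
    (hdiff : Differentiable ℝ ξ)
    (hξ : ∀ x : E, 1 ≤ ‖x‖ → ‖fderiv ℝ ξ x‖ ≤ C * ‖x‖ ^ (-1 - α)) :
    ∃ c : ℝ, ∀ x : E, 1 ≤ ‖x‖ → |ξ x - c| ≤ C / α * ‖x‖ ^ (-α) := by
  have hsphere := isConnected_sphere hE (0 : E) zero_le_one
  obtain ⟨u₀, hu₀⟩ := hsphere.nonempty
  have hdir : ∀ u ∈ Metric.sphere (0 : E) 1,
      Tendsto (fun r : ℝ ↦ ξ (r • u) - ξ (r • u₀)) atTop (nhds 0) := by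
    intro u hu
    refine hsphere.isPreconnected.induction₂
      (fun u v ↦ Tendsto (fun r : ℝ ↦ ξ (r • v) - ξ (r • u)) atTop (nhds 0))
      ?_ ?_ ?_ hu₀ hu
    · intro v hv
      filter_upwards [mem_nhdsWithin_of_mem_nhds (Metric.ball_mem_nhds v one_half_pos)] with w hw
      exact tendsto_sub_smul_of_fderiv_decay hα hC hdiff hξ (by simpa using hv)
        (mem_ball_iff_norm.1 hw)
    · intro x y z _ _ _ hxy hyz
      simpa using hyz.add hxy
    · intro x y _ _ hxy
      simpa using hxy.neg
  have hlim : Tendsto (fun r : ℝ ↦ C / α * r ^ (-α)) atTop (nhds 0) := by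
    simpa using (tendsto_rpow_neg_atTop hα).const_mul (C / α)
  have hcauchy : CauchySeq fun r : ℝ ↦ ξ (r • u₀) := by
    refine Metric.cauchySeq_iff'.2 fun δ hδ ↦ ?_
    obtain ⟨N, hN, hN1⟩ := ((hlim.eventually_lt_const hδ).and (eventually_ge_atTop 1)).exists
    exact ⟨N, fun n hn ↦ (abs_sub_smul_le_of_fderiv_decay hα hC hdiff hξ
      (by simpa using hu₀) hN1 hn).trans_lt hN⟩
  obtain ⟨c, hc⟩ := cauchySeq_tendsto_of_complete hcauchy
  refine ⟨c, fun x hx ↦ ?_⟩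
  have hx0 : ‖x‖ ≠ 0 := by linarith
  have hu : ‖‖x‖⁻¹ • x‖ = 1 := by
    rw [norm_smul, norm_inv, norm_norm, inv_mul_cancel₀ hx0]
  have hxu : ‖x‖ • ‖x‖⁻¹ • x = x := smul_inv_smul₀ hx0 x
  have hcu : Tendsto (fun r : ℝ ↦ ξ (r • ‖x‖⁻¹ • x)) atTop (nhds c) := by
    simpa using (hdir _ (mem_sphere_zero_iff_norm.2 hu)).add hc
  rw [abs_sub_comm]
  refine le_of_tendsto (hcu.sub_const (ξ x)).abs ?_
  filter_upwards [eventually_ge_atTop ‖x‖] with r hr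
  have h := abs_sub_smul_le_of_fderiv_decay hα hC hdiff hξ hu hx hr
  rwa [hxu] at h

end RadialDecay

/-- Key lemma: a gauge parameter `ξ : ℝ³ → ℝ` whose gradient falls off like
`C·‖x‖^(-3/2-ε)` tends to a constant `c` at spatial infinity, with rate
`(π + 2)·C·‖x‖^(-1/2-ε)`. -/
theorem gauge_parameter_asymptotic_constant
    (ε C : ℝ) (hε : 0 < ε) (hC : 0 ≤ C)
    (ξ : EuclideanSpace ℝ (Fin 3) → ℝ)
    (hdiff : Differentiable ℝ ξ)
    (hgrad : ∀ x : EuclideanSpace ℝ (Fin 3), 1 ≤ ‖x‖ →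
      ‖gradient ξ x‖ ≤ C * ‖x‖ ^ (-(3/2 : ℝ) - ε)) :
    ∃ c : ℝ,
      (∀ x : EuclideanSpace ℝ (Fin 3), 1 ≤ ‖x‖ →
        |ξ x - c| ≤ (π + 2) * C * ‖x‖ ^ (-(1/2 : ℝ) - ε)) ∧
      Tendsto ξ (comap norm atTop) (nhds c) := by
  have hα : 0 < 1 / 2 + ε := by linarith
  have hrank : 1 < Module.rank ℝ (EuclideanSpace ℝ (Fin 3)) :=
    Module.lt_rank_of_lt_finrank (by simp)
  obtain ⟨c, hc⟩ := exists_abs_sub_le_of_fderiv_decay hrank hα hC hdiff fun x hx ↦ by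
    have h := hgrad x hx
    rw [gradient, LinearIsometryEquiv.norm_map] at h
    convert h using 3
    ring
  refine ⟨c, fun x hx ↦ (hc x hx).trans ?_, ?_⟩
  · rw [show -(1 / 2 + ε) = -(1 / 2 : ℝ) - ε by ring]
    refine mul_le_mul_of_nonneg_right ?_ (rpow_nonneg (norm_nonneg x) _)
    rw [div_le_iff₀ hα]
    have h1 : 1 ≤ (π + 2) * (1 / 2 + ε) := by nlinarith [pi_pos]
    nlinarith
  · have hlim : Tendsto (fun x : EuclideanSpace ℝ (Fin 3) ↦
        C / (1 / 2 + ε) * ‖x‖ ^ (-(1 / 2 + ε))) (comap norm atTop) (nhds 0) := by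
      rw [← mul_zero (C / (1 / 2 + ε))]
      exact ((tendsto_rpow_neg_atTop hα).comp tendsto_comap).const_mul _
    rw [tendsto_iff_norm_sub_tendsto_zero]
    refine squeeze_zero' (Eventually.of_forall fun x ↦ norm_nonneg _) ?_ hlim
    filter_upwards [tendsto_comap.eventually (eventually_ge_atTop 1)] with x hx
    exact hc x hx
end

section
/- Let ε > 0, C ≥ 0, and let ξ : ℝ³ → ℝ be differentiable with ‖∇ξ(x)‖ ≤ C·‖x‖^(−3/2−ε) for all x with ‖x‖ ≥ 1. Then there exists c ∈ ℝ such that for every unit vector ω ∈ ℝ³ the radial limit lim_{r→∞} ξ(r·ω) exists and equals c; i.e. the asymptotic constant c_{θ,φ} is the same in every angular direction. -/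
open Real Filter

section FallOff

variable {E : Type*} [NormedAddCommGroup E] [NormedSpace ℝ E] {f : E → ℝ} {C a : ℝ}

/-- Mean value estimate along a ray for a function whose derivative decays like a power. -/
theorem abs_sub_le_of_fderiv_decay (ha : 0 < a) (hC : 0 ≤ C) (hf : Differentiable ℝ f)
    (hdecay : ∀ x : E, 1 ≤ ‖x‖ → ‖fderiv ℝ f x‖ ≤ C * ‖x‖ ^ (-a - 1))
    {ω : E} (hω : ‖ω‖ = 1) {r s : ℝ} (hr : 1 ≤ r) (hrs : r ≤ s) :
    |f (s • ω) - f (r • ω)| ≤ C / a * r ^ (-a) := by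
  have hderiv (t : ℝ) : HasDerivAt (fun t : ℝ => f (t • ω) - f (r • ω))
      (fderiv ℝ f (t • ω) ω) t := by
    have h : HasDerivAt (fun t : ℝ => t • ω) ω t := by
      simpa using (hasDerivAt_id t).smul_const ω
    exact ((hf (t • ω)).hasFDerivAt.comp_hasDerivAt t h).sub_const _
  have hbound {t : ℝ} (ht : r ≤ t) : HasDerivAt (fun t : ℝ => C / a * (r ^ (-a) - t ^ (-a)))
      (C * t ^ (-a - 1)) t := by
    have ht0 : t ≠ 0 := by linarith
    have h := ((Real.hasDerivAt_rpow_const (p := -a) (Or.inl ht0)).const_sub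
      (r ^ (-a))).const_mul (C / a)
    refine h.congr_deriv ?_
    field_simp
  have key := image_norm_le_of_norm_deriv_right_le_deriv_boundary'
    (f := fun t : ℝ => f (t • ω) - f (r • ω)) (f' := fun t => fderiv ℝ f (t • ω) ω)
    (a := r) (b := s) (B := fun t : ℝ => C / a * (r ^ (-a) - t ^ (-a)))
    (B' := fun t => C * t ^ (-a - 1))
    (fun t _ => (hderiv t).continuousAt.continuousWithinAt)
    (fun t _ => (hderiv t).hasDerivWithinAt) (by simp)
    (fun t ht => (hbound ht.1).continuousAt.continuousWithinAt)
    (fun t ht => (hbound ht.1).hasDerivWithinAt)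
    (fun t ht => by
      have ht0 : 0 ≤ t := by linarith [ht.1]
      have hn : ‖t • ω‖ = t := by rw [norm_smul, hω, mul_one, Real.norm_of_nonneg ht0]
      have h := hdecay (t • ω) (by rw [hn]; linarith [ht.1])
      rw [hn] at h
      have h' := (fderiv ℝ f (t • ω)).le_opNorm ω
      rw [hω, mul_one] at h'
      exact h'.trans h)
    (Set.right_mem_Icc.2 hrs)
  refine key.trans ?_
  have hs : 0 ≤ s ^ (-a) := Real.rpow_nonneg (by linarith) _
  have hK : 0 ≤ C / a := div_nonneg hC ha.le
  gcongr
  linarith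

theorem exists_tendsto_ray_of_fderiv_decay (ha : 0 < a) (hC : 0 ≤ C) (hf : Differentiable ℝ f)
    (hdecay : ∀ x : E, 1 ≤ ‖x‖ → ‖fderiv ℝ f x‖ ≤ C * ‖x‖ ^ (-a - 1))
    {ω : E} (hω : ‖ω‖ = 1) :
    ∃ l : ℝ, Tendsto (fun r : ℝ => f (r • ω)) atTop (nhds l) := by
  apply cauchySeq_tendsto_of_complete
  rw [Metric.cauchySeq_iff']
  intro δ hδ
  have hlim : Tendsto (fun r : ℝ => C / a * r ^ (-a)) atTop (nhds 0) := by
    simpa using (tendsto_rpow_neg_atTop ha).const_mul (C / a)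
  obtain ⟨N, hN, hN1⟩ := ((hlim.eventually_lt_const hδ).and (eventually_ge_atTop 1)).exists
  exact ⟨N, fun s hs =>
    (abs_sub_le_of_fderiv_decay ha hC hf hdecay hω hN1 hs).trans_lt hN⟩

/-- Differences along nearby rays tend to zero. -/
theorem tendsto_sub_ray_of_fderiv_decay (ha : 0 < a) (hC : 0 ≤ C) (hf : Differentiable ℝ f)
    (hdecay : ∀ x : E, 1 ≤ ‖x‖ → ‖fderiv ℝ f x‖ ≤ C * ‖x‖ ^ (-a - 1))
    {ω ω' : E} (hω : ‖ω‖ = 1) (hclose : ‖ω' - ω‖ ≤ 1 / 2) :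
    Tendsto (fun r : ℝ => f (r • ω') - f (r • ω)) atTop (nhds 0) := by
  have hlim : Tendsto (fun r : ℝ => C * (r / 2) ^ (-a)) atTop (nhds 0) := by
    simpa using ((tendsto_rpow_neg_atTop ha).comp
      (tendsto_id.atTop_div_const (two_pos : (0 : ℝ) < 2))).const_mul C
  refine squeeze_zero_norm' ?_ hlim
  filter_upwards [eventually_ge_atTop 2] with r hr
  have hr0 : 0 < r / 2 := by linarith
  have hdist : ‖r • ω' - r • ω‖ ≤ r / 2 := by
    rw [← smul_sub, norm_smul, Real.norm_of_nonneg (by linarith)]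
    nlinarith
  have hball : ∀ x ∈ Metric.closedBall (r • ω) (r / 2),
      ‖fderiv ℝ f x‖ ≤ C * (r / 2) ^ (-a - 1) := by
    intro x hx
    rw [mem_closedBall_iff_norm'] at hx
    have hn : ‖r • ω‖ = r := by
      rw [norm_smul, hω, mul_one, Real.norm_of_nonneg (by linarith)]
    have hxr : r / 2 ≤ ‖x‖ := by
      have := norm_sub_norm_le (r • ω) x
      linarith
    refine (hdecay x (by linarith)).trans (mul_le_mul_of_nonneg_left ?_ hC)
    exact Real.rpow_le_rpow_of_nonpos hr0 hxr (by linarith)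
  have h := (convex_closedBall (r • ω) (r / 2)).norm_image_sub_le_of_norm_fderiv_le
    (fun x _ => hf x) hball (Metric.mem_closedBall_self hr0.le)
    (mem_closedBall_iff_norm.2 hdist)
  calc ‖f (r • ω') - f (r • ω)‖ ≤ C * (r / 2) ^ (-a - 1) * ‖r • ω' - r • ω‖ := h
    _ ≤ C * (r / 2) ^ (-a - 1) * (r / 2) := by gcongr
    _ = C * (r / 2) ^ (-a) := by
      rw [Real.rpow_sub_one hr0.ne']
      field_simp

theorem exists_forall_tendsto_ray_of_fderiv_decay (hE : 1 < Module.rank ℝ E) (ha : 0 < a)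
    (hC : 0 ≤ C) (hf : Differentiable ℝ f)
    (hdecay : ∀ x : E, 1 ≤ ‖x‖ → ‖fderiv ℝ f x‖ ≤ C * ‖x‖ ^ (-a - 1)) :
    ∃ c : ℝ, ∀ ω : E, ‖ω‖ = 1 → Tendsto (fun r : ℝ => f (r • ω)) atTop (nhds c) := by
  have hex (ω : Metric.sphere (0 : E) 1) :=
    exists_tendsto_ray_of_fderiv_decay ha hC hf hdecay (mem_sphere_zero_iff_norm.1 ω.2)
  choose L hL using hex
  have hconst : IsLocallyConstant L := by
    rw [IsLocallyConstant.iff_eventually_eq]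
    intro ω
    filter_upwards [Metric.closedBall_mem_nhds ω (by norm_num : (0 : ℝ) < 1 / 2)] with ω' hω'
    have hclose : ‖(ω' : E) - ω‖ ≤ 1 / 2 := by
      rwa [Metric.mem_closedBall, Subtype.dist_eq, dist_eq_norm] at hω'
    exact sub_eq_zero.1 (tendsto_nhds_unique ((hL ω').sub (hL ω))
      (tendsto_sub_ray_of_fderiv_decay ha hC hf hdecay
        (mem_sphere_zero_iff_norm.1 ω.2) hclose))
  have : PreconnectedSpace (Metric.sphere (0 : E) 1) :=
    Subtype.preconnectedSpace (isPreconnected_sphere hE 0 1)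
  have : Nontrivial E := rank_pos_iff_nontrivial.1 (zero_lt_one.trans hE)
  obtain ⟨e, he⟩ := exists_norm_eq E zero_le_one
  refine ⟨L ⟨e, mem_sphere_zero_iff_norm.2 he⟩, fun ω hω => ?_⟩
  rw [hconst.apply_eq_of_preconnectedSpace _ ⟨ω, mem_sphere_zero_iff_norm.2 hω⟩]
  exact hL _

end FallOff

/-- Under the gradient fall-off hypothesis `‖∇ξ(x)‖ ≤ C‖x‖^(-3/2-ε)`, the radial limit
`lim_{r→∞} ξ(r·ω)` exists in every unit direction `ω` and is independent of `ω`. -/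
theorem directional_limits_coincide
    (ε C : ℝ) (hε : 0 < ε) (hC : 0 ≤ C)
    (ξ : EuclideanSpace ℝ (Fin 3) → ℝ)
    (hdiff : Differentiable ℝ ξ)
    (hgrad : ∀ x : EuclideanSpace ℝ (Fin 3), 1 ≤ ‖x‖ →
      ‖gradient ξ x‖ ≤ C * ‖x‖ ^ (-(3/2 : ℝ) - ε)) :
    ∃ c : ℝ, ∀ ω : EuclideanSpace ℝ (Fin 3), ‖ω‖ = 1 →
      Tendsto (fun r : ℝ => ξ (r • ω)) atTop (nhds c) := by
  have hrank : 1 < Module.rank ℝ (EuclideanSpace ℝ (Fin 3)) := by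
    rw [← Module.finrank_eq_rank, finrank_euclideanSpace_fin]
    norm_num
  refine exists_forall_tendsto_ray_of_fderiv_decay (a := 1 / 2 + ε) hrank (by linarith) hC hdiff
    fun x hx => ?_
  have h := hgrad x hx
  rw [gradient, LinearIsometryEquiv.norm_map] at h
  convert h using 3
  ring
end
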